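/- For every even n ≥ 4, the center of the dynamical Lie algebra ℒ is the two-dimensional real span of C1 := −X + XX + ∑_{k odd, 1 ≤ k ≤ n−3} (Y^k + Z^k) and C2 := ∑_{k even, 0 ≤ k ≤ n−2} (Y^k + Z^k). -/

import Mathlib

namespace Ising

noncomputable section

open Matrix

attribute [local instance 100] LieRing.ofAssociativeRing

/-- We model `2^n × 2^n` complex matrices as matrices indexed by `Fin n → Fin 2`
(the standard index type for an `n`-fold tensor product of qubits). -/
abbrev M (n : ℕ) := Matrix (Fin n → Fin 2) (Fin n → Fin 2) ℂ

/-- The Pauli matrix σx. -/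
def sx : Matrix (Fin 2) (Fin 2) ℂ := !![0, 1; 1, 0]
/-- The Pauli matrix σy. -/
def sy : Matrix (Fin 2) (Fin 2) ℂ := !![0, Complex.I; -Complex.I, 0]
/-- The Pauli matrix σz. -/
def sz : Matrix (Fin 2) (Fin 2) ℂ := !![1, 0; 0, -1]

/-- The `n`-fold Kronecker product of the `2 × 2` matrices `f 0, …, f (n-1)`. -/
def kron {n : ℕ} (f : Fin n → Matrix (Fin 2) (Fin 2) ℂ) : M n :=
  fun x y => ∏ j, f j (x j) (y j)

/-- The matrix `σ` placed in the `j`-th tensor factor, identity elsewhere (`σ^j`). -/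
def pauliAt (n : ℕ) (σ : Matrix (Fin 2) (Fin 2) ℂ) (j : Fin n) : M n :=
  kron fun i => if i = j then σ else 1

/-- The permutation matrix implementing the cyclic shift of the `n` tensor factors. -/
def P (n : ℕ) : M n :=
  fun x y => if x = (fun i => y (finRotate n i)) then 1 else 0

/-- The symmetrizer `C(A) = ∑_{k=0}^{n-1} Pᵏ A (Pᵏ)⁻¹` over the cyclic group `C_n`. -/
def symmC {n : ℕ} (A : M n) : M n :=
  ∑ k ∈ Finset.range n, P n ^ k * A * (P n ^ k)⁻¹

/-- The Pauli string `a ⊗ σx^{⊗j} ⊗ b ⊗ 1^{⊗(n-j-2)}`. -/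
def str (n : ℕ) (a b : Matrix (Fin 2) (Fin 2) ℂ) (j : ℕ) : M n :=
  kron fun i => if (i : ℕ) = 0 then a else if (i : ℕ) = j + 1 then b
    else if (i : ℕ) ≤ j then sx else 1

/-- `Y^j := i C(σy ⊗ σx^{⊗j} ⊗ σy ⊗ 1^{⊗(n-j-2)})`. -/
def Y (n j : ℕ) : M n := Complex.I • symmC (str n sy sy j)
/-- `Z^j := i C(σz ⊗ σx^{⊗j} ⊗ σz ⊗ 1^{⊗(n-j-2)})`. -/
def Z (n j : ℕ) : M n := Complex.I • symmC (str n sz sz j)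
/-- `YZ^j := i C(σz ⊗ σx^{⊗j} ⊗ σy ⊗ 1^{⊗(n-j-2)}) + i C(σy ⊗ σx^{⊗j} ⊗ σz ⊗ 1^{⊗(n-j-2)})`. -/
def YZ (n j : ℕ) : M n :=
  Complex.I • symmC (str n sz sy j) + Complex.I • symmC (str n sy sz j)
/-- `X := i C(σx ⊗ 1^{⊗(n-1)})`. -/
def X (n : ℕ) : M n :=
  Complex.I • symmC (kron fun i : Fin n => if (i : ℕ) = 0 then sx else 1)
/-- `XX := i C(σx^{⊗(n-1)} ⊗ 1)`. -/
def XX (n : ℕ) : M n :=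
  Complex.I • symmC (kron fun i : Fin n => if (i : ℕ) = n - 1 then 1 else sx)

/-- `H0 = ∑_{j=1}^{n-1} σz^j σz^{j+1} + σz^n σz^1` (cyclically next neighbours). -/
def H0 (n : ℕ) : M n := ∑ j : Fin n, pauliAt n sz j * pauliAt n sz (finRotate n j)
/-- `H1 = ∑_{j=1}^{n} σx^j`. -/
def H1 (n : ℕ) : M n := ∑ j : Fin n, pauliAt n sx j

/-- The dynamical Lie algebra: the smallest real Lie subalgebra of the `2^n × 2^n`
complex matrices (with the commutator bracket) containing `i•H0` and `i•H1`. -/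
def DLA (n : ℕ) : LieSubalgebra ℝ (M n) :=
  LieSubalgebra.lieSpan ℝ (M n) {Complex.I • H0 n, Complex.I • H1 n}

/-- `C1 := -X + XX + ∑_{k odd, 1 ≤ k ≤ n-3} (Y^k + Z^k)` (for even `n`). -/
def C1even (n : ℕ) : M n :=
  -X n + XX n + ∑ k ∈ Finset.range (n - 1), if Odd k then Y n k + Z n k else 0

/-- `C2 := ∑_{k even, 0 ≤ k ≤ n-2} (Y^k + Z^k)` (for even `n`). -/
def C2even (n : ℕ) : M n :=
  ∑ k ∈ Finset.range (n - 1), if Even k then Y n k + Z n k else 0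


theorem kron_mul {n : ℕ} (f g : Fin n → Matrix (Fin 2) (Fin 2) ℂ) :
    kron f * kron g = kron (fun i => f i * g i) := by
  ext x y
  simp only [kron, Matrix.mul_apply, ← Finset.prod_mul_distrib]
  rw [Finset.prod_univ_sum]
  simp [Fintype.piFinset_univ]

theorem kron_one {n : ℕ} : kron (fun _ : Fin n => (1 : Matrix (Fin 2) (Fin 2) ℂ)) = 1 := by
  ext x y
  simp only [kron, Matrix.one_apply]
  by_cases h : x = y
  · subst h; simp
  · rw [if_neg h]
    obtain ⟨j, hj⟩ := Function.ne_iff.mp h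
    exact Finset.prod_eq_zero (Finset.mem_univ j) (if_neg hj)

theorem kron_smul_at {n : ℕ} (f g : Fin n → Matrix (Fin 2) (Fin 2) ℂ) (j : Fin n) (c : ℂ)
    (hj : f j = c • g j) (h : ∀ i, i ≠ j → f i = g i) : kron f = c • kron g := by
  ext x y
  simp only [kron, Matrix.smul_apply, smul_eq_mul]
  rw [← Finset.mul_prod_erase _ _ (Finset.mem_univ j),
    ← Finset.mul_prod_erase _ (fun j => g j (x j) (y j)) (Finset.mem_univ j), hj,
    Matrix.smul_apply, smul_eq_mul, mul_assoc]
  congr 2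
  exact Finset.prod_congr rfl fun i hi => by rw [h i (Finset.ne_of_mem_erase hi)]

theorem P_pow_apply (n k : ℕ) (x y : Fin n → Fin 2) :
    (P n ^ k) x y = if x = (fun i => y (((finRotate n) ^ k) i)) then 1 else 0 := by
  induction k generalizing x with
  | zero => simp [Matrix.one_apply]
  | succ k ih =>
    rw [pow_succ', Matrix.mul_apply]
    simp only [ih]
    rw [Finset.sum_eq_single (fun i => y (((finRotate n) ^ k) i))]
    · simp only [P, if_true, mul_one]
      congr 1
    · intro b _ hb; rw [if_neg hb, mul_zero]
    · simp

theorem rot_val (n : ℕ) (i : Fin n) : ((finRotate n i : Fin n) : ℕ) = (i + 1) % n := by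
  obtain _ | n := n
  · exact i.elim0
  rw [finRotate_apply]
  simp [Fin.val_add]

theorem rot_pow_val (n k : ℕ) (i : Fin n) : (((finRotate n) ^ k) i : ℕ) = (i + k) % n := by
  induction k with
  | zero => simp [Nat.mod_eq_of_lt i.2]
  | succ k ih => rw [pow_succ', Equiv.Perm.mul_apply, rot_val, ih]; simp [Nat.add_assoc]

theorem P_pow_n (n : ℕ) : P n ^ n = 1 := by
  ext x y
  rw [P_pow_apply, Matrix.one_apply]
  have : (finRotate n) ^ n = 1 := by
    ext i; simp [rot_pow_val, Nat.mod_eq_of_lt i.2]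
  simp [this]

/-- inverse of `P` -/
def Pi (n : ℕ) : M n := P n ^ (n - 1)

theorem P_mul_Pi {n : ℕ} (hn : 0 < n) : P n * Pi n = 1 := by
  rw [Pi, ← pow_succ', Nat.sub_add_cancel hn, P_pow_n]

theorem Pi_mul_P {n : ℕ} (hn : 0 < n) : Pi n * P n = 1 := by
  rw [Pi, ← pow_succ, Nat.sub_add_cancel hn, P_pow_n]

theorem P_mul_kron {n : ℕ} (f : Fin n → Matrix (Fin 2) (Fin 2) ℂ) :
    P n * kron f = kron (fun i => f (finRotate n i)) * P n := by
  ext x y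
  rw [Matrix.mul_apply, Matrix.mul_apply]
  rw [Finset.sum_eq_single (fun i => x ((finRotate n).symm i)),
    Finset.sum_eq_single (fun i => y (finRotate n i))]
  · simp only [P, kron]
    simp only [Equiv.symm_apply_apply, if_true, one_mul, mul_one]
    rw [← Equiv.prod_comp (finRotate n)]
    simp only [Equiv.symm_apply_apply]
  · intro b _ hb; simp only [P]; rw [if_neg hb, mul_zero]
  · simp
  · intro b _ hb; simp only [P]; rw [if_neg, zero_mul]
    rintro rfl; apply hb; simp only [Equiv.apply_symm_apply]
  · simp

/-- Conjugation by `P`. -/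
def cj {n : ℕ} (A : M n) : M n := P n * A * Pi n

section
variable {n : ℕ}

theorem cj_add (A B : M n) : cj (A + B) = cj A + cj B := by simp [cj, mul_add, add_mul]
theorem cj_sub (A B : M n) : cj (A - B) = cj A - cj B := by simp [cj, mul_sub, sub_mul]
theorem cj_smul (c : ℂ) (B : M n) : cj (c • B) = c • cj B := by simp [cj]
theorem cj_mul (hn : 0 < n) (A B : M n) : cj (A * B) = cj A * cj B := by
  simp only [cj]
  calc P n * (A * B) * Pi n = P n * A * 1 * B * Pi n := by simp [mul_assoc]
    _ = _ := by rw [← Pi_mul_P hn]; simp only [mul_assoc]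
theorem cj_one (hn : 0 < n) : cj (1 : M n) = 1 := by simp [cj, P_mul_Pi hn]
theorem cj_kron (hn : 0 < n) (f : Fin n → Matrix (Fin 2) (Fin 2) ℂ) :
    cj (kron f) = kron (fun i => f (finRotate n i)) := by
  rw [cj, P_mul_kron, mul_assoc, P_mul_Pi hn, mul_one]
theorem cj_iter (k : ℕ) (A : M n) : cj^[k] A = P n ^ k * A * Pi n ^ k := by
  induction k with
  | zero => simp
  | succ k ih => rw [Function.iterate_succ_apply', ih, cj, pow_succ', pow_succ]; simp only [mul_assoc]
theorem symmC_eq (hn : 0 < n) (A : M n) : symmC A = ∑ k ∈ Finset.range n, cj^[k] A := by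
  refine Finset.sum_congr rfl fun k _ => ?_
  rw [cj_iter, Matrix.inv_eq_right_inv (B := Pi n ^ k)]
  have hc : Commute (P n) (Pi n) := by
    unfold Commute SemiconjBy; rw [P_mul_Pi hn, Pi_mul_P hn]
  rw [← hc.mul_pow, P_mul_Pi hn, one_pow]
theorem cj_iter_n (A : M n) : cj^[n] A = A := by
  rw [cj_iter, P_pow_n, Pi, ← pow_mul, mul_comm (n - 1), pow_mul, P_pow_n]; simp
theorem symmC_cj (hn : 0 < n) (A : M n) : symmC (cj A) = symmC A := by
  rw [symmC_eq hn, symmC_eq hn]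
  have h := Finset.sum_range_succ (fun k => cj^[k] A) n
  rw [Finset.sum_range_succ', cj_iter_n] at h
  simpa using h
theorem symmC_add (A B : M n) : symmC (A + B) = symmC A + symmC B := by
  simp [symmC, mul_add, add_mul, Finset.sum_add_distrib]
theorem symmC_sub (A B : M n) : symmC (A - B) = symmC A - symmC B := by
  simp [symmC, mul_sub, sub_mul, Finset.sum_sub_distrib]
theorem symmC_smul (c : ℂ) (B : M n) : symmC (c • B) = c • symmC B := by
  simp [symmC, Finset.smul_sum]
theorem symmC_neg (B : M n) : symmC (-B) = - symmC B := by
  simp [symmC]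
theorem cj_symmC (hn : 0 < n) (A : M n) : cj (symmC A) = symmC A := by
  conv_rhs => rw [← symmC_cj hn]
  rw [symmC_eq hn, symmC_eq hn]
  simp only [cj, Finset.mul_sum, Finset.sum_mul]
  refine Finset.sum_congr rfl fun k _ => ?_
  change cj (cj^[k] A) = cj^[k] (cj A)
  exact (Function.iterate_succ_apply' cj k A).symm
theorem symmC_comm (hn : 0 < n) (E A : M n) (hE : cj E = E) :
    symmC (E * A - A * E) = E * symmC A - symmC A * E := by
  rw [symmC_eq hn, symmC_eq hn, Finset.mul_sum, Finset.sum_mul, ← Finset.sum_sub_distrib]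
  refine Finset.sum_congr rfl fun k hk => ?_
  clear hk
  induction k with
  | zero => simp
  | succ k ih =>
    rw [Function.iterate_succ_apply', Function.iterate_succ_apply', ih, cj_sub, cj_mul hn,
      cj_mul hn, hE]
end

/-- ordered product `e 0 * e 1 * ⋯ * e (r-1)` -/
def U {R : Type*} [Ring R] (e : ℕ → R) : ℕ → R
  | 0 => 1
  | r + 1 => U e r * e r

theorem U_succ' {R : Type*} [Ring R] (e : ℕ → R) (r : ℕ) :
    U e (r + 1) = e 0 * U (fun k => e (k + 1)) r := by
  induction r with
  | zero => simp [U]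
  | succ r ih => rw [U, ih, U, mul_assoc]

theorem U_comm {R : Type*} [Ring R] (e : ℕ → R) (E : R) (sq : ∀ k, e k * e k = -1)
    (h0 : ∀ j, E * e (2 * j) - e (2 * j) * E = 0)
    (h1 : ∀ j, E * e (2 * j + 1) - e (2 * j + 1) * E =
      2 * (e (2 * j) * e (2 * j + 1)) - 2 * (e (2 * j + 1) * e (2 * j + 2))) (m : ℕ) :
    E * U e (2 * m) - U e (2 * m) * E = 2 * (e 0 * U e (2 * m)) - 2 * U e (2 * m + 1) ∧
    E * U e (2 * m + 1) - U e (2 * m + 1) * E =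
      2 * (e 0 * U e (2 * m + 1)) + 2 * U e (2 * m) := by
  have step : ∀ m, E * U e (2 * m) - U e (2 * m) * E =
      2 * (e 0 * U e (2 * m)) - 2 * U e (2 * m + 1) →
      E * U e (2 * m + 1) - U e (2 * m + 1) * E =
      2 * (e 0 * U e (2 * m + 1)) + 2 * U e (2 * m) := by
    intro m ih
    have a := h0 m
    have b := sq (2 * m)
    simp only [U] at ih ⊢
    generalize U e (2 * m) = u at *
    generalize e (2 * m) = x at *
    calc E * (u * x) - u * x * E = (E * u - u * E) * x + u * (E * x - x * E) := by noncomm_ring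
      _ = 2 * (e 0 * (u * x)) - 2 * (u * (x * x)) := by rw [ih, a]; noncomm_ring
      _ = _ := by rw [b]; noncomm_ring
  induction m with
  | zero =>
    have : E * U e (2 * 0) - U e (2 * 0) * E =
      2 * (e 0 * U e (2 * 0)) - 2 * U e (2 * 0 + 1) := by simp [U]
    exact ⟨this, step 0 this⟩
  | succ m ih =>
    refine ⟨?_, step _ ?_⟩
    all_goals
      have i2 := ih.2
      have a := h1 m
      have b := sq (2 * m)
      simp only [Nat.mul_succ, U] at i2 ⊢
      generalize U e (2 * m) = u at *
      generalize e (2 * m) = x at *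
      generalize e (2 * m + 1) = y at *
      generalize e (2 * m + 2) = z at *
      calc E * (u * x * y) - u * x * y * E
          = (E * (u * x) - u * x * E) * y + u * x * (E * y - y * E) := by noncomm_ring
        _ = 2 * (e 0 * (u * x * y)) + 2 * u * y + 2 * u * (x * x) * y - 2 * (u * x * y * z) := by
          rw [i2, a]; noncomm_ring
        _ = _ := by rw [b]; noncomm_ring

theorem U_comm' {R : Type*} [Ring R] (e : ℕ → R) (E : R) (sq : ∀ k, e k * e k = -1)
    (h0 : ∀ j, E * e (2 * j) - e (2 * j) * E = 0)
    (h1 : ∀ j, E * e (2 * j + 1) - e (2 * j + 1) * E =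
      2 * (e (2 * j) * e (2 * j + 1)) - 2 * (e (2 * j + 1) * e (2 * j + 2)))
    (f : ℕ → R) (hf : f = fun k => e (k + 1)) (m : ℕ) :
    E * U e (2 * m + 1) - U e (2 * m + 1) * E = 2 * U e (2 * m) - 2 * U f (2 * m) ∧
    E * U e (2 * m + 2) - U e (2 * m + 2) * E = - 2 * U f (2 * m + 1) - 2 * U e (2 * m + 3) ∧
    E * U f (2 * m + 1) - U f (2 * m + 1) * E = 2 * U e (2 * m + 2) - 2 * U f (2 * m + 2) ∧
    E * U f (2 * m + 2) - U f (2 * m + 2) * E = 2 * U e (2 * m + 3) + 2 * U f (2 * m + 1) := by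
  have key : ∀ r, e 0 * U e (r + 1) = - U f r := by
    intro r; rw [U_succ', ← hf, ← mul_assoc, sq]; simp
  have kf : ∀ r, E * U f r - U f r * E = - (e 0 * (E * U e (r + 1) - U e (r + 1) * E)) := by
    intro r
    have a := h0 0
    rw [mul_zero] at a
    have h : U f r = - (e 0 * U e (r + 1)) := by rw [key, neg_neg]
    rw [h]
    generalize U e (r + 1) = u at *
    have : E * (-(e 0 * u)) - -(e 0 * u) * E
      = -((E * e 0 - e 0 * E) * u) - e 0 * (E * u - u * E) := by noncomm_ring
    rw [this, a]; simp
  have c := fun m => U_comm e E sq h0 h1 m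
  have s0 : ∀ x : R, e 0 * (e 0 * x) = -x := fun x => by rw [← mul_assoc, sq]; simp
  have t2 : ∀ x : R, e 0 * (2 * x) = 2 * (e 0 * x) := fun x => by noncomm_ring
  refine ⟨?_, ?_, ?_, ?_⟩
  · rw [(c m).2, key]; noncomm_ring
  · have := (c (m + 1)).1
    rw [show 2 * (m + 1) = 2 * m + 1 + 1 by ring] at this
    rw [this, key]; noncomm_ring
  · rw [kf]
    have := (c (m + 1)).1
    rw [show 2 * (m + 1) = 2 * m + 1 + 1 by ring] at this
    rw [this, mul_sub, t2, t2, s0, key]; noncomm_ring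
  · rw [kf]
    have := (c (m + 1)).2
    rw [show 2 * (m + 1) = 2 * m + 1 + 1 by ring] at this
    rw [show 2 * m + 2 + 1 = 2 * m + 1 + 1 + 1 by ring, this, mul_add, t2, t2, s0, key]
    noncomm_ring

/-- `σ` at site `j mod n`. -/
def pA (n : ℕ) (σ : Matrix (Fin 2) (Fin 2) ℂ) (j : ℕ) : M n :=
  kron fun i => if (i : ℕ) = j % n then σ else 1

theorem pA_mod (n : ℕ) (σ : Matrix (Fin 2) (Fin 2) ℂ) (j : ℕ) : pA n σ (j % n) = pA n σ j := by
  simp [pA]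

theorem pA_comm {n : ℕ} (σ τ : Matrix (Fin 2) (Fin 2) ℂ) (i j : ℕ) (h : i % n ≠ j % n) :
    pA n σ i * pA n τ j = pA n τ j * pA n σ i := by
  rw [pA, pA, kron_mul, kron_mul]
  congr 1; funext k
  split_ifs <;> simp_all

theorem pA_mul {n : ℕ} (σ τ : Matrix (Fin 2) (Fin 2) ℂ) (i : ℕ) :
    pA n σ i * pA n τ i = pA n (σ * τ) i := by
  rw [pA, pA, kron_mul, pA]
  congr 1; funext k
  split_ifs <;> simp_all

theorem pA_one {n : ℕ} (i : ℕ) : pA n 1 i = 1 := by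
  simp [pA, kron_one]

theorem pA_smul {n : ℕ} (hn : 0 < n) (c : ℂ) (σ : Matrix (Fin 2) (Fin 2) ℂ) (i : ℕ) :
    pA n (c • σ) i = c • pA n σ i := by
  apply kron_smul_at _ _ ⟨i % n, Nat.mod_lt _ hn⟩
  · simp
  · intro j hj
    have : (j : ℕ) ≠ i % n := fun h => hj (Fin.ext h)
    simp [this]

theorem sx_sq : sx * sx = 1 := by simp [sx, Matrix.one_fin_two]
theorem sz_sq : sz * sz = 1 := by simp [sz, Matrix.one_fin_two]
theorem sx_sz : sx * sz = (-1 : ℂ) • (sz * sx) := by simp [sz, sx]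
theorem sx_sz' : sx * sz = Complex.I • sy := by
  simp [sx, sz, sy]
theorem sz_sx' : sz * sx = (-Complex.I) • sy := by
  simp [sx, sz, sy]

theorem pA_xx {n : ℕ} (i : ℕ) : pA n sx i * pA n sx i = 1 := by rw [pA_mul, sx_sq, pA_one]
theorem pA_zz {n : ℕ} (i : ℕ) : pA n sz i * pA n sz i = 1 := by rw [pA_mul, sz_sq, pA_one]
theorem pA_xz {n : ℕ} (hn : 0 < n) (i : ℕ) :
    pA n sx i * pA n sz i = - (pA n sz i * pA n sx i) := by
  rw [pA_mul, sx_sz, pA_smul hn, pA_mul]; simp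

/-- the local terms -/
def xo (n j : ℕ) : M n := Complex.I • pA n sx j
def zo (n j : ℕ) : M n := Complex.I • (pA n sz j * pA n sz (j + 1))
def ee (n k : ℕ) : M n := if k % 2 = 0 then xo n (k / 2) else zo n (k / 2)

theorem ee_even (n j : ℕ) : ee n (2 * j) = xo n j := by simp [ee]
theorem ee_odd (n j : ℕ) : ee n (2 * j + 1) = zo n j := by
  simp [ee, Nat.add_mod, Nat.mul_add_div]

theorem succ_mod_ne {n : ℕ} (hn : 2 ≤ n) (j : ℕ) : j % n ≠ (j + 1) % n := by
  intro h
  have h2 : 0 ≡ 1 [MOD n] := Nat.ModEq.add_left_cancel' j (show j + 0 ≡ j + 1 [MOD n] from h)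
  unfold Nat.ModEq at h2
  rw [Nat.zero_mod, Nat.mod_eq_of_lt (by omega)] at h2
  omega

theorem xo_sq (n j : ℕ) : xo n j * xo n j = -1 := by
  simp [xo, smul_smul, pA_xx]

theorem zo_sq {n : ℕ} (hn : 2 ≤ n) (j : ℕ) : zo n j * zo n j = -1 := by
  have h := pA_comm sz sz (n := n) j (j + 1) (succ_mod_ne hn j)
  have : pA n sz j * pA n sz (j + 1) * (pA n sz j * pA n sz (j + 1)) = 1 := by
    nth_rewrite 1 [h]
    rw [mul_assoc, ← mul_assoc (pA n sz j), pA_zz, one_mul, pA_zz]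
  simp [zo, smul_smul, this]

theorem ee_sq {n : ℕ} (hn : 2 ≤ n) (k : ℕ) : ee n k * ee n k = -1 := by
  unfold ee; split_ifs
  · exact xo_sq _ _
  · exact zo_sq hn _

theorem cj_pA {n : ℕ} (hn : 0 < n) (σ : Matrix (Fin 2) (Fin 2) ℂ) (j : ℕ) :
    cj (pA n σ (j + 1)) = pA n σ j := by
  rw [pA, cj_kron hn, pA]
  congr 1; funext i
  rw [rot_val]
  have : ((i : ℕ) + 1) % n = (j + 1) % n ↔ (i : ℕ) = j % n := by
    constructor
    · intro h
      have : (i : ℕ) % n = j % n := Nat.ModEq.add_right_cancel' 1 h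
      rwa [Nat.mod_eq_of_lt i.2] at this
    · intro h; rw [h]; simp
  simp only [this]

theorem cj_ee {n : ℕ} (hn : 0 < n) (k : ℕ) : cj (ee n (k + 2)) = ee n k := by
  unfold ee
  have : (k + 2) / 2 = k / 2 + 1 := by omega
  rw [this, Nat.add_mod_right]
  split_ifs
  · simp only [xo, cj_smul, cj_pA hn]
  · simp only [zo, cj_smul, cj_mul hn, cj_pA hn]

theorem cj_U {n : ℕ} (hn : 0 < n) (r : ℕ) : cj (U (fun k => ee n (k + 2)) r) = U (ee n) r := by
  induction r with
  | zero => simp [U, cj_one hn]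
  | succ r ih => rw [U, U, cj_mul hn, ih, cj_ee hn]

def EE (n : ℕ) : M n := ∑ j ∈ Finset.range n, xo n j
def FF (n : ℕ) : M n := ∑ j ∈ Finset.range n, zo n j

theorem xo_mod (n j : ℕ) : xo n (j % n) = xo n j := by simp [xo, pA_mod]
theorem zo_mod (n j : ℕ) : zo n (j % n) = zo n j := by
  have : pA n sz (j % n + 1) = pA n sz (j + 1) := by
    rw [← pA_mod, Nat.mod_add_mod, pA_mod]
  simp [zo, pA_mod, this]

theorem comm_x_z {n : ℕ} (i j : ℕ) (h1 : i % n ≠ j % n) (h2 : i % n ≠ (j + 1) % n) :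
    xo n i * zo n j - zo n j * xo n i = 0 := by
  have a := pA_comm sx sz (n := n) i j h1
  have b := pA_comm sx sz (n := n) i (j + 1) h2
  have : pA n sx i * (pA n sz j * pA n sz (j + 1)) = pA n sz j * pA n sz (j + 1) * pA n sx i := by
    rw [← mul_assoc, a, mul_assoc, b, mul_assoc]
  simp only [xo, zo, smul_mul_smul_comm, this, sub_self]

theorem comm_x_z1 {n : ℕ} (hn : 2 ≤ n) (j : ℕ) :
    xo n j * zo n j = - (zo n j * xo n j) := by
  have a := pA_xz (n := n) (by omega) j
  have b := pA_comm sx sz (n := n) j (j + 1) (succ_mod_ne hn j)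
  have : pA n sx j * (pA n sz j * pA n sz (j + 1)) =
      - (pA n sz j * pA n sz (j + 1) * pA n sx j) := by
    rw [← mul_assoc, a, neg_mul, mul_assoc, b, mul_assoc]
  simp only [xo, zo, smul_mul_smul_comm, this, smul_neg]

theorem comm_x_z2 {n : ℕ} (hn : 2 ≤ n) (j : ℕ) :
    xo n (j + 1) * zo n j = - (zo n j * xo n (j + 1)) := by
  have a := pA_xz (n := n) (by omega) (j + 1)
  have b := pA_comm sx sz (n := n) (j + 1) j (succ_mod_ne hn j).symm
  have : pA n sx (j + 1) * (pA n sz j * pA n sz (j + 1)) =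
      - (pA n sz j * pA n sz (j + 1) * pA n sx (j + 1)) := by
    rw [← mul_assoc, b, mul_assoc, a, mul_neg, mul_assoc]
  simp only [xo, zo, smul_mul_smul_comm, this, smul_neg]

theorem comm_x_x {n : ℕ} (i j : ℕ) : xo n i * xo n j - xo n j * xo n i = 0 := by
  have : pA n sx i * pA n sx j = pA n sx j * pA n sx i := by
    by_cases h : i % n = j % n
    · rw [← pA_mod, h, pA_mod]
    · exact pA_comm _ _ _ _ h
  simp only [xo, smul_mul_smul_comm, this, sub_self]

theorem comm_z_z {n : ℕ} (i j : ℕ) : zo n i * zo n j - zo n j * zo n i = 0 := by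
  have h : ∀ i j, Commute (pA n sz i) (pA n sz j) := by
    intro i j
    by_cases h : i % n = j % n
    · rw [← pA_mod, h, pA_mod]
    · exact pA_comm _ _ _ _ h
  have : Commute (pA n sz i * pA n sz (i + 1)) (pA n sz j * pA n sz (j + 1)) :=
    ((h _ _).mul_left (h _ _)).mul_right ((h _ _).mul_left (h _ _))
  simp only [zo, smul_mul_smul_comm, this.eq, sub_self]

theorem sum_comm {n : ℕ} (f : ℕ → M n) (x : M n) :
    (∑ j ∈ Finset.range n, f j) * x - x * ∑ j ∈ Finset.range n, f j =
      ∑ j ∈ Finset.range n, (f j * x - x * f j) := by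
  rw [Finset.sum_mul, Finset.mul_sum, Finset.sum_sub_distrib]

theorem EE_x (n j : ℕ) : EE n * xo n j - xo n j * EE n = 0 := by
  rw [EE, sum_comm]; exact Finset.sum_eq_zero fun i _ => comm_x_x _ _

theorem FF_z (n j : ℕ) : FF n * zo n j - zo n j * FF n = 0 := by
  rw [FF, sum_comm]; exact Finset.sum_eq_zero fun i _ => comm_z_z _ _

theorem EE_z {n : ℕ} (hn : 2 ≤ n) (j : ℕ) : EE n * zo n j - zo n j * EE n =
    2 * (xo n j * zo n j) - 2 * (zo n j * xo n (j + 1)) := by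
  rw [EE, sum_comm, Finset.sum_eq_add (j % n) ((j + 1) % n) (succ_mod_ne hn j)]
  · rw [xo_mod, xo_mod, comm_x_z2 hn]
    have := comm_x_z1 hn j
    have h2 : zo n j * xo n j = - (xo n j * zo n j) := by rw [this, neg_neg]
    rw [h2]; noncomm_ring
  · intro i hi h
    have hi := Nat.mod_eq_of_lt (Finset.mem_range.mp hi)
    exact comm_x_z _ _ (by rw [hi]; exact h.1) (by rw [hi]; exact h.2)
  · intro h; exact absurd (Finset.mem_range.mpr (Nat.mod_lt _ (by omega))) h
  · intro h; exact absurd (Finset.mem_range.mpr (Nat.mod_lt _ (by omega))) h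

theorem FF_x {n : ℕ} (hn : 2 ≤ n) (j : ℕ) : FF n * xo n (j + 1) - xo n (j + 1) * FF n =
    2 * (zo n j * xo n (j + 1)) - 2 * (xo n (j + 1) * zo n (j + 1)) := by
  rw [FF, sum_comm, Finset.sum_eq_add (j % n) ((j + 1) % n) (succ_mod_ne hn j)]
  · rw [zo_mod, zo_mod, comm_x_z2 hn, comm_x_z1 hn]
    noncomm_ring
  · intro i hi h
    have hi := Nat.mod_eq_of_lt (Finset.mem_range.mp hi)
    have := comm_x_z (n := n) (j + 1) i (by rw [hi]; exact h.2.symm) (by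
      intro h'
      apply h.1
      rw [← hi]
      exact (Nat.ModEq.add_right_cancel' 1 h').symm)
    rw [← neg_sub, this, neg_zero]
  · intro h; exact absurd (Finset.mem_range.mpr (Nat.mod_lt _ (by omega))) h
  · intro h; exact absurd (Finset.mem_range.mpr (Nat.mod_lt _ (by omega))) h

theorem symmC_eq_sum {n : ℕ} (hn : 0 < n) (f : ℕ → M n) (h : ∀ j, cj (f (j + 1)) = f j)
    (hp : f n = f 0) : symmC (f 0) = ∑ j ∈ Finset.range n, f j := by
  have it : ∀ k m, cj^[k] (f (m + k)) = f m := by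
    intro k
    induction k with
    | zero => simp
    | succ k ih => intro m; rw [Function.iterate_succ_apply, ← add_assoc, h, ih]
  rw [← hp, symmC_eq hn]
  have e1 : ∑ k ∈ Finset.range n, cj^[k] (f n) = ∑ k ∈ Finset.range n, f (n - 1 - k + 1) := by
    refine Finset.sum_congr rfl fun k hk => ?_
    have hk := Finset.mem_range.mp hk
    have := it k (n - 1 - k + 1)
    rwa [show n - 1 - k + 1 + k = n by omega] at this
  rw [e1, Finset.sum_range_reflect (fun j => f (j + 1))]
  have h1 := Finset.sum_range_succ f n
  rw [Finset.sum_range_succ', hp] at h1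
  simpa using h1

section
variable {n : ℕ}

theorem xo_n : xo n n = xo n 0 := by rw [← xo_mod, Nat.mod_self]
theorem zo_n : zo n n = zo n 0 := by rw [← zo_mod, Nat.mod_self]

theorem symmC_xo (hn : 0 < n) : symmC (xo n 0) = EE n := by
  apply symmC_eq_sum hn (xo n) _ xo_n
  intro j
  have := cj_ee hn (2 * j)
  rwa [show 2 * j + 2 = 2 * (j + 1) by ring, ee_even, ee_even] at this

theorem symmC_zo (hn : 0 < n) : symmC (zo n 0) = FF n := by
  apply symmC_eq_sum hn (zo n) _ zo_n
  intro j
  have := cj_ee hn (2 * j + 1)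
  rwa [show 2 * j + 1 + 2 = 2 * (j + 1) + 1 by ring, ee_odd, ee_odd] at this

theorem cj_EE (hn : 0 < n) : cj (EE n) = EE n := by rw [← symmC_xo hn, cj_symmC hn]
theorem cj_FF (hn : 0 < n) : cj (FF n) = FF n := by rw [← symmC_zo hn, cj_symmC hn]

theorem H1_eq : Complex.I • H1 n = EE n := by
  rw [H1, EE, Finset.sum_range, Finset.smul_sum]
  refine Finset.sum_congr rfl fun j _ => ?_
  rw [xo, pauliAt, pA]
  congr 2; funext i
  simp [Nat.mod_eq_of_lt j.2, Fin.ext_iff]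

theorem H0_eq : Complex.I • H0 n = FF n := by
  rw [H0, FF, Finset.sum_range, Finset.smul_sum]
  refine Finset.sum_congr rfl fun j _ => ?_
  rw [zo, pauliAt, pauliAt, pA, pA]
  congr 3
  · funext i
    simp [Nat.mod_eq_of_lt j.2, Fin.ext_iff]
  · funext i
    simp only [Fin.ext_iff, rot_val]

theorem X_eq (hn : 0 < n) : X n = EE n := by
  rw [← symmC_xo hn, X, xo, symmC_smul, pA, Nat.zero_mod]

end

/-- shifted local terms -/
def ff (n k : ℕ) : M n := ee n (k + 1)
def gg (n k : ℕ) : M n := ee n (k + 2)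

def AA (n : ℕ) : ℕ → M n
  | 0 => - EE n
  | m + 1 => symmC (U (ff n) (2 * m + 1))
def BB (n m : ℕ) : M n := symmC (U (ee n) (2 * m + 1))
def GG (n m : ℕ) : M n := symmC (U (ee n) (2 * m)) - symmC (U (ff n) (2 * m))

section
variable {n : ℕ}

theorem symmC_two (A : M n) : symmC (2 * A) = 2 * symmC A := by
  rw [two_mul, symmC_add, two_mul]
theorem symmC_ntwo (A : M n) : symmC (-2 * A) = -2 * symmC A := by
  rw [neg_mul, symmC_neg, symmC_two, neg_mul]

theorem BB_zero (hn : 0 < n) : BB n 0 = EE n := by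
  simp [BB, U, ← symmC_xo hn, ee]
theorem AA_zero : AA n 0 = - EE n := rfl
theorem AA_one (hn : 0 < n) : AA n 1 = FF n := by
  simp [AA, U, ← symmC_zo hn, ff, ee]
theorem GG_zero : GG n 0 = 0 := by simp [GG, U]

theorem EU (hn : 2 ≤ n) (m : ℕ) :
    EE n * U (ee n) (2 * m + 1) - U (ee n) (2 * m + 1) * EE n =
      2 * U (ee n) (2 * m) - 2 * U (ff n) (2 * m) ∧
    EE n * U (ee n) (2 * m + 2) - U (ee n) (2 * m + 2) * EE n =
      - 2 * U (ff n) (2 * m + 1) - 2 * U (ee n) (2 * m + 3) ∧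
    EE n * U (ff n) (2 * m + 1) - U (ff n) (2 * m + 1) * EE n =
      2 * U (ee n) (2 * m + 2) - 2 * U (ff n) (2 * m + 2) ∧
    EE n * U (ff n) (2 * m + 2) - U (ff n) (2 * m + 2) * EE n =
      2 * U (ee n) (2 * m + 3) + 2 * U (ff n) (2 * m + 1) :=
  U_comm' (ee n) (EE n) (ee_sq hn)
    (fun j => by rw [ee_even, EE_x])
    (fun j => by
      rw [show 2 * j + 2 = 2 * (j + 1) by ring, ee_even, ee_even, ee_odd, EE_z hn])
    (ff n) rfl m

theorem FU (hn : 2 ≤ n) (m : ℕ) :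
    FF n * U (ff n) (2 * m + 1) - U (ff n) (2 * m + 1) * FF n =
      2 * U (ff n) (2 * m) - 2 * U (gg n) (2 * m) ∧
    FF n * U (ff n) (2 * m + 2) - U (ff n) (2 * m + 2) * FF n =
      - 2 * U (gg n) (2 * m + 1) - 2 * U (ff n) (2 * m + 3) ∧
    FF n * U (gg n) (2 * m + 1) - U (gg n) (2 * m + 1) * FF n =
      2 * U (ff n) (2 * m + 2) - 2 * U (gg n) (2 * m + 2) ∧
    FF n * U (gg n) (2 * m + 2) - U (gg n) (2 * m + 2) * FF n =
      2 * U (ff n) (2 * m + 3) + 2 * U (gg n) (2 * m + 1) :=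
  U_comm' (ff n) (FF n) (fun k => ee_sq hn (k + 1))
    (fun j => by rw [ff, ee_odd, FF_z])
    (fun j => by
      simp only [ff]
      rw [show 2 * j + 1 + 1 = 2 * (j + 1) by ring,
        ee_even, ee_odd, ee_odd, FF_x hn])
    (gg n) rfl m

theorem symmC_gg (hn : 0 < n) (r : ℕ) : symmC (U (gg n) r) = symmC (U (ee n) r) := by
  rw [← cj_U hn, symmC_cj hn]; rfl

theorem E_symm (hn : 0 < n) (A : M n) : ⁅EE n, symmC A⁆ = symmC (EE n * A - A * EE n) := by
  rw [symmC_comm hn _ _ (cj_EE hn)]; rfl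
theorem F_symm (hn : 0 < n) (A : M n) : ⁅FF n, symmC A⁆ = symmC (FF n * A - A * FF n) := by
  rw [symmC_comm hn _ _ (cj_FF hn)]; rfl

theorem E_A (hn : 2 ≤ n) (m : ℕ) : ⁅EE n, AA n m⁆ = 2 * GG n m := by
  obtain _ | m := m
  · simp [AA, GG_zero]
  · rw [AA, E_symm (by omega), (EU hn m).2.2.1, symmC_sub, symmC_two, symmC_two, GG,
      mul_sub]; rfl
theorem E_B (hn : 2 ≤ n) (m : ℕ) : ⁅EE n, BB n m⁆ = 2 * GG n m := by
  rw [BB, E_symm (by omega), (EU hn m).1, symmC_sub, symmC_two, symmC_two, GG, mul_sub]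
theorem E_G (hn : 2 ≤ n) (m : ℕ) :
    ⁅EE n, GG n (m + 1)⁆ = -4 * (AA n (m + 1) + BB n (m + 1)) := by
  rw [GG, lie_sub, E_symm (by omega), E_symm (by omega), show 2 * (m + 1) = 2 * m + 2 by ring,
    (EU hn m).2.1, (EU hn m).2.2.2, symmC_sub, symmC_add, symmC_two, symmC_two,
    symmC_ntwo, AA, BB, show 2 * (m + 1) + 1 = 2 * m + 3 by ring]
  noncomm_ring
theorem F_A (hn : 2 ≤ n) (m : ℕ) : ⁅FF n, AA n (m + 1)⁆ = -2 * GG n m := by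
  rw [AA, F_symm (by omega), (FU hn m).1, symmC_sub, symmC_two, symmC_two, GG,
      symmC_gg (by omega)]
  noncomm_ring
theorem F_B (hn : 2 ≤ n) (m : ℕ) : ⁅FF n, BB n m⁆ = -2 * GG n (m + 1) := by
  rw [BB, ← symmC_gg (by omega), F_symm (by omega), (FU hn m).2.2.1, symmC_sub, symmC_two,
    symmC_two, GG, symmC_gg (by omega), show 2 * (m + 1) = 2 * m + 2 by ring]
  noncomm_ring
theorem F_A0 (hn : 2 ≤ n) : ⁅FF n, AA n 0⁆ = 2 * GG n 1 := by
  rw [AA, lie_neg, ← BB_zero (by omega), F_B hn]; noncomm_ring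
theorem F_G (hn : 2 ≤ n) (m : ℕ) :
    ⁅FF n, GG n (m + 1)⁆ = 4 * (AA n (m + 2) + BB n m) := by
  rw [GG, ← symmC_gg (by omega), lie_sub, F_symm (by omega), F_symm (by omega),
    show 2 * (m + 1) = 2 * m + 2 by ring,
    (FU hn m).2.1, (FU hn m).2.2.2, symmC_sub, symmC_add, symmC_two, symmC_two,
    symmC_ntwo, symmC_gg (by omega), AA, BB, show 2 * (m + 1) + 1 = 2 * m + 3 by ring]
  noncomm_ring

theorem str_step (m : ℕ) (hm : m + 2 < n) :
    str n sz sz m * pA n sx (m + 1) * (pA n sz (m + 1) * pA n sz (m + 2)) =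
      (-1 : ℂ) • str n sz sz (m + 1) := by
  rw [str, pA, pA, pA, kron_mul, kron_mul, kron_mul, str]
  have h1 : (m + 1) % n = m + 1 := Nat.mod_eq_of_lt (by omega)
  have h2 : (m + 2) % n = m + 2 := Nat.mod_eq_of_lt (by omega)
  rw [h1, h2]
  apply kron_smul_at _ _ ⟨m + 1, by omega⟩
  · simp [sz, sx]
  · intro i hi
    have hi : (i : ℕ) ≠ m + 1 := fun h => hi (Fin.ext h)
    by_cases a : (i : ℕ) = 0
    · simp [a]
    by_cases b : (i : ℕ) = m + 2
    · simp [b]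
    by_cases c : (i : ℕ) ≤ m
    · have : (i : ℕ) ≤ m + 1 := by omega
      simp [a, b, c, hi, this]
    · have : ¬ (i : ℕ) ≤ m + 1 := by omega
      simp [a, b, c, hi, this]

theorem Uf_succ (m : ℕ) : U (ff n) (2 * (m + 1) + 1) =
    U (ff n) (2 * m + 1) * xo n (m + 1) * zo n (m + 1) := by
  rw [show 2 * (m + 1) + 1 = 2 * m + 1 + 1 + 1 by ring, U, U, ff, ff,
    show 2 * m + 1 + 1 = 2 * (m + 1) by ring, ee_even, ee_odd]

theorem Uf_eq (hn : 2 ≤ n) (m : ℕ) (hm : m + 2 ≤ n) :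
    U (ff n) (2 * m + 1) = Complex.I • str n sz sz m := by
  induction m with
  | zero =>
    have : U (ff n) (2 * 0 + 1) = zo n 0 := by simp [U, ff, ee]
    rw [this, zo, pA, pA, kron_mul, str]
    congr 2; funext i
    rw [Nat.zero_mod, Nat.mod_eq_of_lt (by omega)]
    by_cases a : (i : ℕ) = 0
    · simp [a]
    · simp [a]
  | succ m ih =>
    rw [Uf_succ, ih (by omega), xo, zo, smul_mul_smul_comm, smul_mul_smul_comm,
      str_step m (by omega), smul_smul]
    congr 1; simp

/-- the string with 1 at site 0 and σx elsewhere -/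
def KK (n : ℕ) : M n := kron fun i : Fin n => if (i : ℕ) = 0 then 1 else sx

theorem str_top (N : ℕ) :
    str (N + 2) sz sz N * pA (N + 2) sx (N + 1) * (pA (N + 2) sz (N + 1) * pA (N + 2) sz (N + 2)) =
      (-1 : ℂ) • KK (N + 2) := by
  rw [str, pA, pA, pA, kron_mul, kron_mul, kron_mul, KK]
  have h1 : (N + 1) % (N + 2) = N + 1 := Nat.mod_eq_of_lt (by omega)
  rw [h1, Nat.mod_self]
  apply kron_smul_at _ _ ⟨N + 1, by omega⟩
  · simp [sz, sx]
  · intro i hi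
    have hi : (i : ℕ) ≠ N + 1 := fun h => hi (Fin.ext h)
    by_cases a : (i : ℕ) = 0
    · simp [a, sz_sq]
    · have : (i : ℕ) ≤ N := by have := i.2; omega
      simp [a, hi, this]

theorem Uf_top (N : ℕ) : U (ff (N + 2)) (2 * (N + 1) + 1) = Complex.I • KK (N + 2) := by
  rw [Uf_succ, Uf_eq (by omega) N (by omega), xo, zo, smul_mul_smul_comm, smul_mul_smul_comm,
      str_top, smul_smul]
  congr 1; simp

theorem KK_comm : KK n * xo n 0 = xo n 0 * KK n := by
  have : KK n * pA n sx 0 = pA n sx 0 * KK n := by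
    rw [KK, pA, kron_mul, kron_mul]; congr 1; funext i
    split_ifs <;> simp_all
  rw [xo, Matrix.mul_smul, Matrix.smul_mul, this]

theorem XX_eq (hn : 0 < n) : XX n = Complex.I • symmC (KK n) := by
  rw [XX, ← symmC_cj hn (KK n), KK, cj_kron hn]
  congr 3; funext i
  have := i.2
  rw [rot_val]
  have : ((i : ℕ) = n - 1) ↔ ((i : ℕ) + 1) % n = 0 := by
    constructor
    · intro h; rw [h, Nat.sub_add_cancel hn, Nat.mod_self]
    · intro h
      by_contra h'
      rw [Nat.mod_eq_of_lt (by omega)] at h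
      omega
  simp [this]

theorem AA_top (hn : 2 ≤ n) : AA n n = XX n := by
  rw [XX_eq (by omega)]
  obtain ⟨N, rfl⟩ : ∃ N, n = N + 2 := ⟨n - 2, by omega⟩
  rw [AA, Uf_top, symmC_smul]

theorem Ue_succ (r : ℕ) : U (ee n) (r + 1) = xo n 0 * U (ff n) r := by
  rw [U_succ']; rfl

theorem BB_top (hn : 2 ≤ n) : BB n n = - AA n n := by
  obtain ⟨N, rfl⟩ : ∃ N, n = N + 2 := ⟨n - 2, by omega⟩
  rw [AA, BB, ← symmC_neg, Ue_succ]
  congr 1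
  rw [show 2 * (N + 2) = 2 * (N + 1) + 1 + 1 by ring, U, Uf_top, ff,
    show 2 * (N + 1) + 1 + 1 = 2 * (N + 2) by ring, ee_even, xo_n, Matrix.smul_mul, KK_comm,
    Matrix.mul_smul, ← mul_assoc, xo_sq]
  simp

theorem GG_top (hn : 2 ≤ n) : GG n n = 0 := by
  obtain ⟨N, rfl⟩ : ∃ N, n = N + 2 := ⟨n - 2, by omega⟩
  rw [GG, ← symmC_sub, show 2 * (N + 2) = 2 * (N + 1) + 1 + 1 by ring, Ue_succ,
    U.eq_2 (ff (N + 2)) (2 * (N + 1) + 1), Uf_top, ff,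
    show 2 * (N + 1) + 1 + 1 = 2 * (N + 2) by ring, ee_even, xo_n, Matrix.smul_mul, KK_comm,
    Matrix.mul_smul, sub_self]
  simp [symmC]

theorem AA_eq (hn : 2 ≤ n) (m : ℕ) (hm : m + 2 ≤ n) : AA n (m + 1) = Z n m := by
  rw [AA, Uf_eq hn m hm, symmC_smul, Z]

theorem str_yy (hn : 2 ≤ n) (m : ℕ) (hm : m + 2 ≤ n) :
    pA n sx 0 * str n sz sz m * pA n sx (m + 1) = str n sy sy m := by
  have h1 : (m + 1) % n = m + 1 := Nat.mod_eq_of_lt (by omega)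
  let mid : M n := kron fun i => if (i : ℕ) = 0 then sy else if (i : ℕ) = m + 1 then sz * sx
    else if (i : ℕ) ≤ m then sx else 1
  have e1 : pA n sx 0 * str n sz sz m * pA n sx (m + 1) = Complex.I • mid := by
    rw [str, pA, pA, kron_mul, kron_mul, h1, Nat.zero_mod]
    apply kron_smul_at _ _ ⟨0, by omega⟩
    · simp [sx_sz']
    · intro i hi
      have hi : (i : ℕ) ≠ 0 := fun h => hi (Fin.ext h)
      by_cases b : (i : ℕ) = m + 1
      · simp [b]
      · simp [b, hi]
  have e2 : mid = (-Complex.I) • str n sy sy m := by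
    rw [str]
    apply kron_smul_at _ _ ⟨m + 1, by omega⟩
    · simp [sz_sx']
    · intro i hi
      have hi : (i : ℕ) ≠ m + 1 := fun h => hi (Fin.ext h)
      simp [hi]
  rw [e1, e2, smul_smul]; simp

theorem BB_eq (hn : 2 ≤ n) (m : ℕ) (hm : m + 2 ≤ n) : BB n (m + 1) = - Y n m := by
  rw [BB, Y, ← symmC_smul, ← symmC_neg, Ue_succ, show 2 * (m + 1) = 2 * m + 1 + 1 by ring, U,
    Uf_eq hn m hm, ff, show 2 * m + 1 + 1 = 2 * (m + 1) by ring, ee_even, ← mul_assoc, xo, xo,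
    smul_mul_smul_comm, smul_mul_smul_comm, str_yy hn m hm]
  simp
end

theorem trace_kron {n : ℕ} (f : Fin n → Matrix (Fin 2) (Fin 2) ℂ) :
    (kron f).trace = ∏ i, (f i).trace := by
  simp only [Matrix.trace, Matrix.diag_apply, kron]
  rw [Finset.prod_univ_sum]
  simp [Fintype.piFinset_univ]

/-- product functional -/
def La {n : ℕ} (ρ : Matrix (Fin 2) (Fin 2) ℂ) : M n →ₗ[ℂ] ℂ where
  toFun A := (A * kron fun _ => ρ).trace
  map_add' A B := by simp [add_mul]
  map_smul' c A := by simp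

theorem La_kron {n : ℕ} (ρ : Matrix (Fin 2) (Fin 2) ℂ) (f : Fin n → Matrix (Fin 2) (Fin 2) ℂ) :
    La ρ (kron f) = ∏ i, (f i * ρ).trace := by
  change (kron f * kron _).trace = _
  rw [kron_mul, trace_kron]

theorem La_cj {n : ℕ} (hn : 0 < n) (ρ : Matrix (Fin 2) (Fin 2) ℂ) (A : M n) :
    La ρ (cj A) = La ρ A := by
  change (cj A * kron _).trace = (A * kron _).trace
  have h : P n * kron (fun _ => ρ) = kron (fun _ => ρ) * P n := P_mul_kron _
  rw [cj, Matrix.trace_mul_comm, ← mul_assoc, ← mul_assoc, ← h, mul_assoc, mul_assoc,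
    Matrix.trace_mul_comm, mul_assoc, mul_assoc, Pi_mul_P hn, mul_one, Matrix.trace_mul_comm,
    Matrix.trace_mul_comm]

theorem La_symmC {n : ℕ} (hn : 0 < n) (ρ : Matrix (Fin 2) (Fin 2) ℂ) (A : M n) :
    La ρ (symmC A) = n * La ρ A := by
  have : ∀ k, La ρ (cj^[k] A) = La ρ A := by
    intro k
    induction k with
    | zero => rfl
    | succ k ih => rw [Function.iterate_succ_apply', La_cj hn, ih]
  rw [symmC_eq hn, map_sum]
  simp [this]

def rho (s t u : ℂ) : Matrix (Fin 2) (Fin 2) ℂ :=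
  !![(1 + t) / 2, (s + u * Complex.I) / 2; (s - u * Complex.I) / 2, (1 - t) / 2]

theorem rho_one (s t u : ℂ) : (rho s t u).trace = 1 := by
  simp [rho, Matrix.trace_fin_two]; ring
theorem rho_x (s t u : ℂ) : (sx * rho s t u).trace = s := by
  simp [rho, Matrix.trace_fin_two, sx]; ring
theorem rho_z (s t u : ℂ) : (sz * rho s t u).trace = t := by
  simp [rho, Matrix.trace_fin_two, sz]; ring
theorem rho_y (s t u : ℂ) : (sy * rho s t u).trace = u := by
  simp [rho, Matrix.trace_fin_two, sy]; ring_nf; simp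

theorem prod_str {n : ℕ} (m : ℕ) (hm : m + 2 ≤ n) (s t : ℂ) :
    ∏ i : Fin n, (if (i : ℕ) = 0 then t else if (i : ℕ) = m + 1 then t
      else if (i : ℕ) ≤ m then s else 1) = t * t * s ^ m := by
  rw [Fin.prod_univ_eq_prod_range (fun i => if i = 0 then t else if i = m + 1 then t
      else if i ≤ m then s else 1)]
  obtain ⟨d, rfl⟩ := Nat.exists_eq_add_of_le hm
  rw [Finset.prod_range_add, Finset.prod_range_succ, Finset.prod_range_succ']
  rw [Finset.prod_eq_one (s := Finset.range d), Finset.prod_congr rfl (g := fun _ => s)]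
  · simp; ring
  · intro k hk
    have := Finset.mem_range.mp hk
    rw [if_neg (by omega), if_neg (by omega), if_pos (by omega)]
  · intro k hk
    rw [if_neg (by omega), if_neg (by omega), if_neg (by omega)]

theorem La_Z {n : ℕ} (m : ℕ) (hm : m + 2 ≤ n) (s t u : ℂ) :
    La (rho s t u) (Z n m) = n * Complex.I * (t * t * s ^ m) := by
  rw [Z, map_smul, La_symmC (by omega), str, La_kron, ← prod_str m hm, smul_eq_mul]
  have : ∀ i : Fin n, ((if (i : ℕ) = 0 then sz else if (i : ℕ) = m + 1 then sz
      else if (i : ℕ) ≤ m then sx else 1) * rho s t u).trace =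
      (if (i : ℕ) = 0 then t else if (i : ℕ) = m + 1 then t
      else if (i : ℕ) ≤ m then s else 1) := by
    intro i; split_ifs <;> simp [rho_one, rho_x, rho_z]
  simp only [this]; ring

theorem La_Y {n : ℕ} (m : ℕ) (hm : m + 2 ≤ n) (s t u : ℂ) :
    La (rho s t u) (Y n m) = n * Complex.I * (u * u * s ^ m) := by
  rw [Y, map_smul, La_symmC (by omega), str, La_kron, ← prod_str m hm, smul_eq_mul]
  have : ∀ i : Fin n, ((if (i : ℕ) = 0 then sy else if (i : ℕ) = m + 1 then sy
      else if (i : ℕ) ≤ m then sx else 1) * rho s t u).trace =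
      (if (i : ℕ) = 0 then u else if (i : ℕ) = m + 1 then u
      else if (i : ℕ) ≤ m then s else 1) := by
    intro i; split_ifs <;> simp [rho_one, rho_x, rho_y]
  simp only [this]; ring

theorem La_X {n : ℕ} (hn : 0 < n) (s t u : ℂ) :
    La (rho s t u) (X n) = n * Complex.I * s := by
  rw [X, map_smul, La_symmC hn, La_kron, smul_eq_mul]
  obtain ⟨N, rfl⟩ : ∃ N, n = N + 1 := ⟨n - 1, by omega⟩
  rw [Fin.prod_univ_succ]
  simp [rho_x, rho_one]; ring

theorem La_XX {n : ℕ} (hn : 0 < n) (s t u : ℂ) :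
    La (rho s t u) (XX n) = n * Complex.I * s ^ (n - 1) := by
  rw [XX_eq hn, KK, map_smul, La_symmC hn, La_kron, smul_eq_mul]
  obtain ⟨N, rfl⟩ : ∃ N, n = N + 1 := ⟨n - 1, by omega⟩
  rw [Fin.prod_univ_succ]
  simp [rho_x, rho_one]; ring

/-- general combination of the `A`s and `B`s -/
def TT (n : ℕ) (α β : ℕ → ℝ) : M n := α 0 • AA n 0 + α n • AA n n +
  ∑ k ∈ Finset.range (n - 1), (α (k + 1) • AA n (k + 1) + β (k + 1) • BB n (k + 1))
def VV (n : ℕ) (g : ℕ → ℝ) : M n := ∑ k ∈ Finset.range (n - 1), g (k + 1) • GG n (k + 1)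

theorem real_smul_eq {n : ℕ} (c : ℝ) (A : M n) : c • A = (c : ℂ) • A := by
  ext i j; simp

theorem La_TT {n : ℕ} (hn : 2 ≤ n) (α β : ℕ → ℝ) (s t u : ℂ) :
    La (rho s t u) (TT n α β) = n * Complex.I * (- α 0 * s + α n * s ^ (n - 1) +
      ∑ k ∈ Finset.range (n - 1), ((α (k + 1) : ℂ) * t * t * s ^ k
        - (β (k + 1) : ℂ) * u * u * s ^ k)) := by
  rw [TT]
  simp only [real_smul_eq, map_add, map_smul, map_sum]
  rw [AA_top hn, AA_zero, ← X_eq (by omega), map_neg, La_X (by omega), La_XX (by omega)]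
  have : ∀ k ∈ Finset.range (n - 1), (α (k + 1) : ℂ) • La (rho s t u) (AA n (k + 1)) +
      (β (k + 1) : ℂ) • La (rho s t u) (BB n (k + 1)) =
      n * Complex.I * ((α (k + 1) : ℂ) * t * t * s ^ k - (β (k + 1) : ℂ) * u * u * s ^ k) := by
    intro k hk
    have hk := Finset.mem_range.mp hk
    rw [AA_eq hn k (by omega), BB_eq hn k (by omega), map_neg, La_Z k (by omega),
      La_Y k (by omega)]
    simp only [smul_eq_mul]; ring
  rw [Finset.sum_congr rfl this, ← Finset.mul_sum]
  simp only [smul_eq_mul]; ring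

theorem poly_zero (N : ℕ) (a : ℕ → ℝ) (h : ∀ s : ℂ, ∑ k ∈ Finset.range N, (a k : ℂ) * s ^ k = 0) :
    ∀ k < N, a k = 0 := by
  intro k hk
  let p : Polynomial ℂ := ∑ k ∈ Finset.range N, Polynomial.C (a k : ℂ) * Polynomial.X ^ k
  have hp : p = 0 := by
    apply Polynomial.funext
    intro s
    simp only [p, Polynomial.eval_finsetSum, Polynomial.eval_mul, Polynomial.eval_C,
      Polynomial.eval_pow, Polynomial.eval_X, Polynomial.eval_zero, h]
  have := congrArg (fun q => Polynomial.coeff q k) hp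
  simp only [p, Polynomial.finsetSum_coeff, Polynomial.coeff_C_mul_X_pow] at this
  simpa [hk] using this

theorem TT_li {n : ℕ} (hn : 3 ≤ n) (α β : ℕ → ℝ) (h : TT n α β = 0) :
    α 0 = 0 ∧ α n = 0 ∧ (∀ k < n - 1, α (k + 1) = 0) ∧ (∀ k < n - 1, β (k + 1) = 0) := by
  have key : ∀ s t u : ℂ, - α 0 * s + α n * s ^ (n - 1) +
      ∑ k ∈ Finset.range (n - 1), ((α (k + 1) : ℂ) * t * t * s ^ k
        - (β (k + 1) : ℂ) * u * u * s ^ k) = 0 := by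
    intro s t u
    have := La_TT (n := n) (by omega) α β s t u
    rw [h, map_zero] at this
    have hne : (n : ℂ) * Complex.I ≠ 0 := by
      apply mul_ne_zero _ Complex.I_ne_zero
      exact_mod_cast (by omega : n ≠ 0)
    exact (mul_eq_zero.mp this.symm).resolve_left hne
  have k1 := key 1 0 0
  have k2 := key 2 0 0
  simp at k1 k2
  have k1' : - α 0 + α n = 0 := by exact_mod_cast k1
  have k2' : - (α 0 * 2) + α n * 2 ^ (n - 1) = 0 := by exact_mod_cast k2
  have hp : (4 : ℝ) ≤ 2 ^ (n - 1) := by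
    calc (4 : ℝ) = 2 ^ 2 := by norm_num
      _ ≤ 2 ^ (n - 1) := pow_le_pow_right₀ (by norm_num) (by omega)
  have e : α n = α 0 := by linarith
  have z0 : α 0 = 0 := by
    rw [e] at k2'
    have : α 0 * (2 ^ (n - 1) - 2) = 0 := by linarith
    rcases mul_eq_zero.mp this with h | h
    · exact h
    · linarith
  refine ⟨z0, by rw [e, z0], ?_, ?_⟩
  · apply poly_zero (n - 1) (fun k => α (k + 1))
    intro s
    have := key s 1 0
    rw [e, z0] at this
    simpa using this
  · apply poly_zero (n - 1) (fun k => β (k + 1))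
    intro s
    have := key s 0 1
    rw [e, z0] at this
    simpa using this

/-- entrywise complex conjugation -/
def kj (n : ℕ) : M n →+* M n := (starRingEnd ℂ).mapMatrix

theorem kj_smul {n : ℕ} (c : ℝ) (A : M n) : kj n (c • A) = c • kj n A := by
  ext i j; simp [kj]
theorem kj_Ismul {n : ℕ} (A : M n) : kj n (Complex.I • A) = - (Complex.I • kj n A) := by
  ext i j; simp [kj]
theorem kj_kron {n : ℕ} (f : Fin n → Matrix (Fin 2) (Fin 2) ℂ) :
    kj n (kron f) = kron (fun i => (f i).map (starRingEnd ℂ)) := by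
  ext i j; simp [kj, kron]
theorem kj_P {n : ℕ} : kj n (P n) = P n := by
  ext i j; simp [kj, P, apply_ite]
theorem kj_cj {n : ℕ} (A : M n) : kj n (cj A) = cj (kj n A) := by
  simp [cj, Pi, kj_P]
theorem kj_symmC {n : ℕ} (hn : 0 < n) (A : M n) : kj n (symmC A) = symmC (kj n A) := by
  rw [symmC_eq hn, symmC_eq hn, map_sum]
  refine Finset.sum_congr rfl fun k hk => ?_
  clear hk
  induction k with
  | zero => rfl
  | succ k ih => rw [Function.iterate_succ_apply', Function.iterate_succ_apply', kj_cj, ih]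

theorem kj_pA {n : ℕ} (σ : Matrix (Fin 2) (Fin 2) ℂ) (h : σ.map (starRingEnd ℂ) = σ) (j : ℕ) :
    kj n (pA n σ j) = pA n σ j := by
  rw [pA, kj_kron]; congr 1; funext i
  split_ifs
  · exact h
  · simp [Matrix.map_one]

theorem kj_ee {n : ℕ} (k : ℕ) : kj n (ee n k) = - ee n k := by
  have hx : sx.map (starRingEnd ℂ) = sx := by
    ext i j; fin_cases i <;> fin_cases j <;> simp [sx]
  have hz : sz.map (starRingEnd ℂ) = sz := by
    ext i j; fin_cases i <;> fin_cases j <;> simp [sz]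
  unfold ee; split_ifs
  · rw [xo, kj_Ismul, kj_pA _ hx]
  · rw [zo, kj_Ismul, map_mul, kj_pA _ hz, kj_pA _ hz]

theorem kj_U {n : ℕ} (e : ℕ → M n) (h : ∀ k, kj n (e k) = - e k) (m : ℕ) :
    kj n (U e (2 * m)) = U e (2 * m) ∧ kj n (U e (2 * m + 1)) = - U e (2 * m + 1) := by
  have st : ∀ m, kj n (U e (2 * m)) = U e (2 * m) → kj n (U e (2 * m + 1)) = - U e (2 * m + 1) := by
    intro m hm; rw [U, map_mul, hm, h, mul_neg]
  induction m with
  | zero => exact ⟨by simp [U], st 0 (by simp [U])⟩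
  | succ m ih =>
    have : kj n (U e (2 * (m + 1))) = U e (2 * (m + 1)) := by
      rw [show 2 * (m + 1) = 2 * m + 1 + 1 by ring, U, map_mul, ih.2, h, neg_mul_neg]
    exact ⟨this, st _ this⟩

theorem kj_BB {n : ℕ} (hn : 0 < n) (m : ℕ) : kj n (BB n m) = - BB n m := by
  rw [BB, kj_symmC hn, (kj_U _ kj_ee m).2, symmC_neg]
theorem kj_AA {n : ℕ} (hn : 0 < n) (m : ℕ) : kj n (AA n m) = - AA n m := by
  obtain _ | m := m
  · rw [AA, ← BB_zero hn, map_neg, kj_BB hn]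
  · rw [AA, kj_symmC hn, (kj_U (ff n) (fun k => kj_ee (k + 1)) m).2, symmC_neg]
theorem kj_GG {n : ℕ} (hn : 0 < n) (m : ℕ) : kj n (GG n m) = GG n m := by
  rw [GG, map_sub, kj_symmC hn, kj_symmC hn, (kj_U _ kj_ee m).1,
    (kj_U (ff n) (fun k => kj_ee (k + 1)) m).1]

theorem kj_TT {n : ℕ} (hn : 0 < n) (α β : ℕ → ℝ) : kj n (TT n α β) = - TT n α β := by
  simp only [TT, map_add, map_sum, kj_smul, kj_AA hn, kj_BB hn, neg_add, smul_neg,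
    ← Finset.sum_neg_distrib]
theorem kj_VV {n : ℕ} (hn : 0 < n) (g : ℕ → ℝ) : kj n (VV n g) = VV n g := by
  simp only [VV, map_sum, kj_smul, kj_GG hn]

theorem separate {n : ℕ} (hn : 0 < n) (α β g : ℕ → ℝ) (h : TT n α β + VV n g = 0) :
    TT n α β = 0 ∧ VV n g = 0 := by
  have h2 := congrArg (kj n) h
  rw [map_add, kj_TT hn, kj_VV hn, map_zero] at h2
  have e : VV n g = TT n α β := by rwa [neg_add_eq_zero, eq_comm] at h2
  rw [e] at h
  have : TT n α β = 0 := by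
    rw [← two_smul ℝ] at h
    exact (smul_eq_zero.mp h).resolve_left two_ne_zero
  exact ⟨this, by rw [e, this]⟩

section
variable {n : ℕ}

theorem nm2 (A : M n) : 2 * A = (2 : ℝ) • A := by rw [two_mul, two_smul]
theorem nm4 (A : M n) : 4 * A = (4 : ℝ) • A := by
  rw [show (4 : M n) = 2 * 2 by norm_num, mul_assoc, nm2, nm2, smul_smul]; norm_num
theorem nmn2 (A : M n) : -2 * A = (-2 : ℝ) • A := by rw [neg_mul, nm2, neg_smul]
theorem nmn4 (A : M n) : -4 * A = (-4 : ℝ) • A := by rw [neg_mul, nm4, neg_smul]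

theorem E_TT (hn : 2 ≤ n) (α β : ℕ → ℝ) :
    ⁅EE n, TT n α β⁆ = (2 : ℝ) • VV n (fun k => α k + β k) := by
  simp only [TT, VV, lie_add, lie_sum, lie_smul, E_A hn, E_B hn, GG_zero, GG_top hn, nm2]
  simp only [smul_zero, zero_add, Finset.smul_sum]
  refine Finset.sum_congr rfl fun k _ => ?_
  module

theorem E_VV (hn : 2 ≤ n) (g : ℕ → ℝ) :
    ⁅EE n, VV n g⁆ = (-4 : ℝ) •
      TT n (fun k => if k = 0 ∨ k = n then 0 else g k) g := by
  simp only [TT, VV, lie_add, lie_sum, lie_smul, E_G hn, nmn4]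
  simp only [true_or, or_true, if_true, zero_smul, zero_add, Finset.smul_sum]
  refine Finset.sum_congr rfl fun k hk => ?_
  have := Finset.mem_range.mp hk
  rw [if_neg (by omega)]
  module

theorem VV_li (hn : 3 ≤ n) (g : ℕ → ℝ) (h : VV n g = 0) : ∀ k < n - 1, g (k + 1) = 0 := by
  have h2 := E_VV (n := n) (by omega) g
  rw [h, lie_zero] at h2
  have h3 := (smul_eq_zero.mp h2.symm).resolve_left (by norm_num)
  exact (TT_li hn _ _ h3).2.2.2

theorem F_TT (hn : 2 ≤ n) (α : ℕ → ℝ) :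
    ⁅FF n, TT n α (fun k => - α k)⁆ = (2 : ℝ) • VV n (fun k => α (k - 1) - α (k + 1)) := by
  obtain ⟨N, rfl⟩ : ∃ N, n = N + 1 := ⟨n - 1, by omega⟩
  simp only [TT, VV, lie_add, lie_sum, lie_smul, F_A0 hn, F_A hn, F_B hn, nm2, nmn2,
    Nat.add_sub_cancel]
  have e1 := Finset.sum_range_succ' (fun k => α k • GG (N + 1) (k + 1)) N
  rw [Finset.sum_range_succ, GG_top hn, smul_zero, add_zero] at e1
  have e2 := Finset.sum_range_succ (fun k => α (k + 1) • GG (N + 1) k) N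
  rw [Finset.sum_range_succ', GG_zero, smul_zero, add_zero] at e2
  have e3 : ∑ k ∈ Finset.range N, (α k - α (k + 1 + 1)) • GG (N + 1) (k + 1) =
      ∑ k ∈ Finset.range N, α k • GG (N + 1) (k + 1) -
      ∑ k ∈ Finset.range N, α (k + 1 + 1) • GG (N + 1) (k + 1) := by
    rw [← Finset.sum_sub_distrib]; simp only [sub_smul]
  rw [e3, e1, e2]
  have e4 : ∑ k ∈ Finset.range N, (α (k + 1) • (-2 : ℝ) • GG (N + 1) k +
      -α (k + 1) • (-2 : ℝ) • GG (N + 1) (k + 1 + 1)) =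
      (2 : ℝ) • (∑ k ∈ Finset.range N, α (k + 1) • GG (N + 1) (k + 1 + 1) -
        ∑ k ∈ Finset.range N, α (k + 1) • GG (N + 1) k) := by
    rw [← Finset.sum_sub_distrib, Finset.smul_sum]
    refine Finset.sum_congr rfl fun k _ => ?_
    module
  rw [e4]
  module

theorem TT_add (α β α' β' : ℕ → ℝ) : TT n α β + TT n α' β' = TT n (α + α') (β + β') := by
  simp only [TT, Pi.add_apply, add_smul, Finset.sum_add_distrib]; abel
theorem VV_add (g g' : ℕ → ℝ) : VV n g + VV n g' = VV n (g + g') := by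
  simp only [VV, Pi.add_apply, add_smul, Finset.sum_add_distrib]
theorem TT_smul (c : ℝ) (α β : ℕ → ℝ) : c • TT n α β = TT n (c • α) (c • β) := by
  simp only [TT, Pi.smul_apply, smul_eq_mul, mul_smul, Finset.smul_sum, smul_add]
theorem VV_smul (c : ℝ) (g : ℕ → ℝ) : c • VV n g = VV n (c • g) := by
  simp only [VV, Pi.smul_apply, smul_eq_mul, mul_smul, Finset.smul_sum]

/-- spanning set -/
def SS (n : ℕ) : Submodule ℝ (M n) :=
  Submodule.span ℝ {x | ∃ m ≤ n, x = AA n m ∨ x = BB n m ∨ x = GG n m}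

theorem A_mem (m : ℕ) (hm : m ≤ n) : AA n m ∈ SS n :=
  Submodule.subset_span ⟨m, hm, Or.inl rfl⟩
theorem B_mem (m : ℕ) (hm : m ≤ n) : BB n m ∈ SS n :=
  Submodule.subset_span ⟨m, hm, Or.inr (Or.inl rfl)⟩
theorem G_mem (m : ℕ) (hm : m ≤ n) : GG n m ∈ SS n :=
  Submodule.subset_span ⟨m, hm, Or.inr (Or.inr rfl)⟩

theorem E_stable (hn : 2 ≤ n) (x : M n) (hx : x ∈ SS n) : ⁅EE n, x⁆ ∈ SS n := by
  induction hx using Submodule.span_induction with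
  | mem x h =>
    obtain ⟨m, hm, rfl | rfl | rfl⟩ := h
    · rw [E_A hn, nm2]; exact Submodule.smul_mem _ _ (G_mem m hm)
    · rw [E_B hn, nm2]; exact Submodule.smul_mem _ _ (G_mem m hm)
    · obtain _ | m := m
      · rw [GG_zero, lie_zero]; exact zero_mem _
      · rw [E_G hn, nmn4]
        exact Submodule.smul_mem _ _ (add_mem (A_mem _ hm) (B_mem _ hm))
  | zero => rw [lie_zero]; exact zero_mem _
  | add x y _ _ hx hy => rw [lie_add]; exact add_mem hx hy
  | smul c x _ hx => rw [lie_smul]; exact Submodule.smul_mem _ _ hx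

theorem F_stable (hn : 2 ≤ n) (x : M n) (hx : x ∈ SS n) : ⁅FF n, x⁆ ∈ SS n := by
  have hA : ∀ m ≤ n, ⁅FF n, AA n m⁆ ∈ SS n := by
    intro m hm
    obtain _ | m := m
    · rw [F_A0 hn, nm2]; exact Submodule.smul_mem _ _ (G_mem _ (by omega))
    · rw [F_A hn, nmn2]; exact Submodule.smul_mem _ _ (G_mem _ (by omega))
  induction hx using Submodule.span_induction with
  | mem x h =>
    obtain ⟨m, hm, rfl | rfl | rfl⟩ := h
    · exact hA m hm
    · rcases hm.eq_or_lt with rfl | h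
      · rw [BB_top hn, lie_neg]; exact neg_mem (hA _ le_rfl)
      · rw [F_B hn, nmn2]; exact Submodule.smul_mem _ _ (G_mem _ (by omega))
    · rcases hm.eq_or_lt with rfl | h
      · rw [GG_top hn, lie_zero]; exact zero_mem _
      obtain _ | m := m
      · rw [GG_zero, lie_zero]; exact zero_mem _
      · rw [F_G hn, nm4]
        exact Submodule.smul_mem _ _ (add_mem (A_mem _ (by omega)) (B_mem _ (by omega)))
  | zero => rw [lie_zero]; exact zero_mem _
  | add x y _ _ hx hy => rw [lie_add]; exact add_mem hx hy
  | smul c x _ hx => rw [lie_smul]; exact Submodule.smul_mem _ _ hx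

/-- elements of `S` normalizing `S` -/
def NN (n : ℕ) : LieSubalgebra ℝ (M n) where
  carrier := {x | x ∈ SS n ∧ ∀ y ∈ SS n, ⁅x, y⁆ ∈ SS n}
  add_mem' := fun {a b} ha hb => ⟨add_mem ha.1 hb.1, fun y hy => by
    rw [add_lie]; exact add_mem (ha.2 y hy) (hb.2 y hy)⟩
  zero_mem' := ⟨zero_mem _, fun y _ => by rw [zero_lie]; exact zero_mem _⟩
  smul_mem' := fun c x hx => ⟨Submodule.smul_mem _ _ hx.1, fun y hy => by
    rw [smul_lie]; exact Submodule.smul_mem _ _ (hx.2 y hy)⟩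
  lie_mem' := fun {a b} ha hb => ⟨ha.2 b hb.1, fun y hy => by
    rw [lie_lie]; exact sub_mem (ha.2 _ (hb.2 y hy)) (hb.2 _ (ha.2 y hy))⟩

theorem DLA_le_SS (hn : 2 ≤ n) (x : M n) (hx : x ∈ DLA n) : x ∈ SS n := by
  have : DLA n ≤ NN n := by
    apply LieSubalgebra.lieSpan_le.mpr
    rintro x (rfl | rfl)
    · rw [H0_eq]
      exact ⟨by rw [← AA_one (by omega)]; exact A_mem _ (by omega), F_stable hn⟩
    · rw [H1_eq]
      exact ⟨by rw [← BB_zero (by omega)]; exact B_mem _ (by omega), E_stable hn⟩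
  exact (this hx).1

theorem delta_sum (N j : ℕ) (hj : j < N) (f : ℕ → M n) :
    ∑ k ∈ Finset.range N, (if k + 1 = j + 1 then (1 : ℝ) else 0) • f k = f j := by
  rw [Finset.sum_eq_single j]
  · simp
  · intro k _ hk; rw [if_neg (by omega), zero_smul]
  · intro h; exact absurd (Finset.mem_range.mpr hj) h

theorem zero_comb : TT n 0 0 = 0 ∧ VV n 0 = 0 := by
  constructor
  · simp [TT]
  · simp [VV]

theorem SS_comb (hn : 2 ≤ n) (x : M n) (hx : x ∈ SS n) : ∃ α β g, x = TT n α β + VV n g := by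
  have hA0 : ∃ α β, AA n 0 = TT n α β := by
    refine ⟨fun k => if k = 0 then 1 else 0, 0, ?_⟩
    have : n ≠ 0 := by omega
    simp [TT, this]
  have hAn : ∃ α β, AA n n = TT n α β := by
    refine ⟨fun k => if k = n then 1 else 0, 0, ?_⟩
    have : 0 ≠ n := by omega
    simp only [TT, if_neg this]
    rw [Finset.sum_eq_zero]
    · simp
    · intro k hk
      have := Finset.mem_range.mp hk
      rw [if_neg (by omega)]; simp
  have hA : ∀ m ≤ n, ∃ α β, AA n m = TT n α β := by
    intro m hm
    rcases hm.eq_or_lt with rfl | h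
    · exact hAn
    obtain _ | m := m
    · exact hA0
    · refine ⟨fun k => if k = m + 1 then 1 else 0, 0, ?_⟩
      have h1 : 0 ≠ m + 1 := by omega
      have h2 : n ≠ m + 1 := by omega
      simp only [TT, if_neg h1, if_neg h2, Pi.zero_apply, zero_smul, add_zero]
      rw [delta_sum (n - 1) m (by omega) (fun k => AA n (k + 1)), zero_add]
  have hneg : ∀ x : M n, (∃ α β, x = TT n α β) → ∃ α β, - x = TT n α β := by
    rintro x ⟨α, β, rfl⟩
    refine ⟨(-1 : ℝ) • α, (-1 : ℝ) • β, ?_⟩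
    rw [← TT_smul, neg_one_smul]
  have hB : ∀ m ≤ n, ∃ α β, BB n m = TT n α β := by
    intro m hm
    rcases hm.eq_or_lt with rfl | h
    · rw [BB_top hn]; exact hneg _ hAn
    obtain _ | m := m
    · have : BB n 0 = - AA n 0 := by rw [BB_zero (by omega), AA_zero, neg_neg]
      rw [this]; exact hneg _ hA0
    · refine ⟨0, fun k => if k = m + 1 then 1 else 0, ?_⟩
      simp only [TT, Pi.zero_apply, zero_smul, zero_add]
      rw [delta_sum (n - 1) m (by omega) (fun k => BB n (k + 1))]
  have hG : ∀ m ≤ n, ∃ g, GG n m = VV n g := by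
    intro m hm
    rcases hm.eq_or_lt with rfl | h
    · exact ⟨0, by rw [GG_top hn, zero_comb.2]⟩
    obtain _ | m := m
    · exact ⟨0, by rw [GG_zero, zero_comb.2]⟩
    · refine ⟨fun k => if k = m + 1 then 1 else 0, ?_⟩
      simp only [VV]
      rw [delta_sum (n - 1) m (by omega) (fun k => GG n (k + 1))]
  induction hx using Submodule.span_induction with
  | mem x h =>
    obtain ⟨m, hm, rfl | rfl | rfl⟩ := h
    · obtain ⟨α, β, h⟩ := hA m hm
      exact ⟨α, β, 0, by rw [zero_comb.2, add_zero, h]⟩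
    · obtain ⟨α, β, h⟩ := hB m hm
      exact ⟨α, β, 0, by rw [zero_comb.2, add_zero, h]⟩
    · obtain ⟨g, h⟩ := hG m hm
      exact ⟨0, 0, g, by rw [zero_comb.1, zero_add, h]⟩
  | zero => exact ⟨0, 0, 0, by rw [zero_comb.1, zero_comb.2, add_zero]⟩
  | add x y _ _ hx hy =>
    obtain ⟨α, β, g, rfl⟩ := hx
    obtain ⟨α', β', g', rfl⟩ := hy
    exact ⟨α + α', β + β', g + g', by rw [← TT_add, ← VV_add]; abel⟩
  | smul c x _ hx =>
    obtain ⟨α, β, g, rfl⟩ := hx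
    exact ⟨c • α, c • β, c • g, by rw [← TT_smul, ← VV_smul, smul_add]⟩

theorem EE_mem : EE n ∈ DLA n := by
  rw [← H1_eq]; exact LieSubalgebra.subset_lieSpan (by simp)
theorem FF_mem : FF n ∈ DLA n := by
  rw [← H0_eq]; exact LieSubalgebra.subset_lieSpan (by simp)

theorem AB_mem (hn : 2 ≤ n) (m : ℕ) : AA n m ∈ DLA n ∧ BB n m ∈ DLA n ∧ AA n (m + 1) ∈ DLA n := by
  have half : ∀ (c : ℝ) (x : M n), c ≠ 0 → c • x ∈ DLA n → x ∈ DLA n := by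
    intro c x hc h
    have := (DLA n).smul_mem c⁻¹ h
    rwa [smul_smul, inv_mul_cancel₀ hc, one_smul] at this
  have hG : ∀ m, AA n m ∈ DLA n → GG n m ∈ DLA n := by
    intro m h
    have := (DLA n).lie_mem EE_mem h
    rw [E_A hn, nm2] at this
    exact half _ _ (by norm_num) this
  induction m with
  | zero =>
    refine ⟨neg_mem EE_mem, ?_, ?_⟩
    · rw [BB_zero (by omega)]; exact EE_mem
    · rw [AA_one (by omega)]; exact FF_mem
  | succ m ih =>
    obtain ⟨h1, h2, h3⟩ := ih
    have g := hG _ h3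
    refine ⟨h3, ?_, ?_⟩
    · have := (DLA n).lie_mem EE_mem g
      rw [E_G hn, nmn4] at this
      have := half _ _ (by norm_num) this
      have h4 := sub_mem this h3
      rwa [add_sub_cancel_left] at h4
    · have := (DLA n).lie_mem FF_mem g
      rw [F_G hn, nm4] at this
      have := half _ _ (by norm_num) this
      have h4 := sub_mem this h2
      rwa [add_sub_cancel_right] at h4

theorem TT_mem (hn : 2 ≤ n) (α β : ℕ → ℝ) : TT n α β ∈ DLA n := by
  unfold TT
  refine add_mem (add_mem ((DLA n).smul_mem _ (AB_mem hn _).1)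
    ((DLA n).smul_mem _ (AB_mem hn _).1)) (sum_mem fun k _ => add_mem
      ((DLA n).smul_mem _ (AB_mem hn _).1) ((DLA n).smul_mem _ (AB_mem hn _).2.1))

theorem central (x : M n) (hE : ⁅EE n, x⁆ = 0) (hF : ⁅FF n, x⁆ = 0) (y : M n) (hy : y ∈ DLA n) :
    ⁅x, y⁆ = 0 := by
  let K : LieSubalgebra ℝ (M n) :=
    { carrier := {y | ⁅y, x⁆ = 0}
      add_mem' := fun {a b} ha hb => by
        change ⁅a + b, x⁆ = 0
        rw [add_lie, show ⁅a, x⁆ = 0 from ha, show ⁅b, x⁆ = 0 from hb, add_zero]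
      zero_mem' := zero_lie x
      smul_mem' := fun c a ha => by
        change ⁅c • a, x⁆ = 0
        rw [smul_lie, show ⁅a, x⁆ = 0 from ha, smul_zero]
      lie_mem' := fun {a b} ha hb => by
        change ⁅⁅a, b⁆, x⁆ = 0
        rw [lie_lie, show ⁅a, x⁆ = 0 from ha, show ⁅b, x⁆ = 0 from hb, lie_zero, lie_zero,
          sub_zero] }
  have : DLA n ≤ K := by
    apply LieSubalgebra.lieSpan_le.mpr
    rintro z (rfl | rfl)
    · rw [H0_eq]; exact hF
    · rw [H1_eq]; exact hE
  have h : ⁅y, x⁆ = 0 := this hy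
  rw [← lie_skew, h, neg_zero]

/-- 2-periodic coefficients -/
def per (s t : ℝ) (k : ℕ) : ℝ := if Even k then s else t

theorem C1_eq (hn : 2 ≤ n) (he : Even n) : C1even n = TT n (per 1 0) (fun k => - per 1 0 k) := by
  rw [C1even, TT, X_eq (by omega), AA_zero, AA_top hn]
  simp only [per, he, if_true, Even.zero, one_smul]
  congr 1
  refine Finset.sum_congr rfl fun k hk => ?_
  have := Finset.mem_range.mp hk
  rw [AA_eq hn k (by omega), BB_eq hn k (by omega)]
  by_cases h : Even k
  · have h' : ¬ Odd k := by simpa using h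
    have h2 : ¬ Even (k + 1) := by simpa [Nat.even_add_one] using h
    simp [h', h2]
  · have h' : Odd k := by simpa using h
    have h2 : Even (k + 1) := by simpa [Nat.even_add_one] using h
    simp [h', h2, add_comm]

theorem C2_eq (hn : 2 ≤ n) (he : Even n) : C2even n = TT n (per 0 1) (fun k => - per 0 1 k) := by
  rw [C2even, TT]
  simp only [per, he, if_true, Even.zero, zero_smul, zero_add]
  refine Finset.sum_congr rfl fun k hk => ?_
  have := Finset.mem_range.mp hk
  rw [AA_eq hn k (by omega), BB_eq hn k (by omega)]
  by_cases h : Even k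
  · have h2 : ¬ Even (k + 1) := by simpa [Nat.even_add_one] using h
    simp [h, h2, add_comm]
  · have h2 : Even (k + 1) := by simpa [Nat.even_add_one] using h
    simp [h, h2]

theorem C_comb (hn : 2 ≤ n) (he : Even n) (s t : ℝ) :
    s • C1even n + t • C2even n = TT n (per s t) (fun k => - per s t k) := by
  rw [C1_eq hn he, C2_eq hn he, TT_smul, TT_smul, TT_add]
  congr 1 <;>
  · funext k
    by_cases h : Even k <;> simp [per, h]

theorem C_central (hn : 2 ≤ n) (s t : ℝ) :
    ⁅EE n, TT n (per s t) (fun k => - per s t k)⁆ = 0 ∧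
    ⁅FF n, TT n (per s t) (fun k => - per s t k)⁆ = 0 := by
  constructor
  · rw [E_TT hn]
    simp [VV]
  · rw [F_TT hn, VV]
    rw [Finset.sum_eq_zero, smul_zero]
    intro k _
    have : per s t (k + 1 + 1) = per s t k := by simp [per, Nat.even_add_one]
    rw [Nat.add_sub_cancel, this, sub_self, zero_smul]

theorem TT_congr (α β α' β' : ℕ → ℝ) (h1 : ∀ k ≤ n, α k = α' k)
    (h2 : ∀ k < n - 1, β (k + 1) = β' (k + 1)) : TT n α β = TT n α' β' := by
  unfold TT
  rw [h1 0 (by omega), h1 n le_rfl]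
  congr 1
  refine Finset.sum_congr rfl fun k hk => ?_
  have hk := Finset.mem_range.mp hk
  rw [h1 (k + 1) (by omega), h2 k hk]

theorem center_sub (hn : 3 ≤ n) (x : M n) (hx : x ∈ DLA n) (hE : ⁅EE n, x⁆ = 0)
    (hF : ⁅FF n, x⁆ = 0) : ∃ s t, x = TT n (per s t) (fun k => - per s t k) := by
  have hn2 : 2 ≤ n := by omega
  obtain ⟨α, β, g, rfl⟩ := SS_comb hn2 x (DLA_le_SS hn2 x hx)
  rw [lie_add, E_TT hn2, E_VV hn2, TT_smul, VV_smul, add_comm] at hE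
  obtain ⟨e1, e2⟩ := separate (by omega) _ _ _ hE
  have hg : ∀ k < n - 1, g (k + 1) = 0 := by
    intro k hk
    have := (TT_li hn _ _ e1).2.2.2 k hk
    simpa using this
  have hab : ∀ k < n - 1, β (k + 1) = - α (k + 1) := by
    intro k hk
    have := VV_li hn _ e2 k hk
    simp only [Pi.smul_apply, smul_eq_mul] at this
    linarith
  have hV : VV n g = 0 := by
    unfold VV
    apply Finset.sum_eq_zero
    intro k hk
    rw [hg k (Finset.mem_range.mp hk), zero_smul]
  rw [hV, add_zero] at hF ⊢
  rw [TT_congr α β α (fun k => - α k) (fun _ _ => rfl) hab] at hF ⊢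
  rw [F_TT hn2] at hF
  have hF := (smul_eq_zero.mp hF).resolve_left (by norm_num)
  have hp := VV_li hn _ hF
  have key : ∀ k ≤ n, α k = per (α 0) (α 1) k := by
    intro k
    induction k using Nat.twoStepInduction with
    | zero => simp [per]
    | one => simp [per]
    | more k ih _ =>
      intro hk
      have h := hp k (by omega)
      rw [Nat.add_sub_cancel] at h
      have h2 : per (α 0) (α 1) (k + 2) = per (α 0) (α 1) k := by simp [per, Nat.even_add_one]
      rw [h2, ← ih (by omega)]
      linarith
  refine ⟨α 0, α 1, TT_congr _ _ _ _ key ?_⟩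
  intro k hk
  rw [key (k + 1) (by omega)]

end

/-- For every even `n ≥ 4`, the center of the dynamical Lie algebra
is the two-dimensional real span of `C1` and `C2`. -/
theorem stmt3 (n : ℕ) (hn : 4 ≤ n) (heven : Even n) :
    {A : M n | A ∈ DLA n ∧ ∀ B ∈ DLA n, ⁅A, B⁆ = 0} =
      (Submodule.span ℝ ({C1even n, C2even n} : Set (M n)) : Set (M n)) ∧
    Module.finrank ℝ (Submodule.span ℝ ({C1even n, C2even n} : Set (M n))) = 2 := by
  have hn2 : 2 ≤ n := by omega
  constructor
  · ext x
    simp only [Set.mem_setOf_eq, SetLike.mem_coe, Submodule.mem_span_pair, C_comb hn2 heven]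
    constructor
    · rintro ⟨hx, hc⟩
      have hE : ⁅EE n, x⁆ = 0 := by rw [← lie_skew, hc _ EE_mem, neg_zero]
      have hF : ⁅FF n, x⁆ = 0 := by rw [← lie_skew, hc _ FF_mem, neg_zero]
      obtain ⟨s, t, h⟩ := center_sub (by omega) x hx hE hF
      exact ⟨s, t, h.symm⟩
    · rintro ⟨s, t, rfl⟩
      exact ⟨TT_mem hn2 _ _, central _ (C_central hn2 s t).1 (C_central hn2 s t).2⟩
  · have hli : LinearIndependent ℝ ![C1even n, C2even n] := by
      rw [LinearIndependent.pair_iff]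
      intro s t h
      rw [C_comb hn2 heven] at h
      obtain ⟨h0, _, h1, _⟩ := TT_li (by omega) _ _ h
      have h1 := h1 0 (by omega)
      simp [per] at h0 h1
      exact ⟨h0, h1⟩
    have := finrank_span_eq_card hli
    have hr : Set.range ![C1even n, C2even n] = {C1even n, C2even n} := by
      ext x
      simp only [Set.mem_range, Fin.exists_fin_two, Set.mem_insert_iff, Set.mem_singleton_iff]
      simp [eq_comm]
    rw [hr] at this
    simpa using this

end
end Ising
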